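/- If ℂ[x,x⁻¹] has an invariant subspace other than 0 and ℂ[x,x⁻¹] (i.e. j₀M is reducible), then there exists an integer k such that x^k ℂ[x] (the span of the monomials x^n with n ≥ k) is an invariant subspace. -/

import Mathlib

noncomputable section

/-- The Laurent polynomial ring `ℂ[x,x⁻¹]`, viewed as the space of finitely supported
coefficient functions `ℤ →₀ ℂ`; the monomial `x^n` is `Finsupp.single n 1`. -/
abbrev LaurentC : Type := ℤ →₀ ℂ

/-- The `ℂ`-linear endomorphism of `ℂ[x,x⁻¹]` determined by its values on the monomials
`x^n`, `n : ℤ`. -/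
noncomputable def onMonomials (g : ℤ → LaurentC) : LaurentC →ₗ[ℂ] LaurentC :=
  Finsupp.lsum ℂ fun n => LinearMap.toSpanSingleton ℂ LaurentC (g n)

/-- Multiplication by `x`. -/
noncomputable def mulX : LaurentC →ₗ[ℂ] LaurentC :=
  onMonomials fun n => Finsupp.single (n + 1) 1

/-- The operator `s_i : x^n ↦ λ^{i n} x^n`. -/
noncomputable def sOp (lam : ℂ) (i : ℕ) : LaurentC →ₗ[ℂ] LaurentC :=
  onMonomials fun n => Finsupp.single n (lam ^ ((i : ℤ) * n))

/-- The Dunkl operator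
`D(x^n) = n x^{n-1} + p·x^n + Σ_{i=1}^{m-1} (2 c_i (1-λ^{in})/(1-λ^i)) x^{n-1}`. -/
noncomputable def dunkl (m : ℕ) (lam : ℂ) (c : ℕ → ℂ) (p : LaurentC) : LaurentC →ₗ[ℂ] LaurentC :=
  onMonomials fun n =>
    Finsupp.mapDomain (· + n) p +
      ((n : ℂ) + ∑ i ∈ Finset.Icc 1 (m - 1),
          2 * c i * (1 - lam ^ ((i : ℤ) * n)) / (1 - lam ^ (i : ℤ))) • Finsupp.single (n - 1) 1

/-- A subspace `N ⊆ ℂ[x,x⁻¹]` is an invariant subspace if it is closed under multiplication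
by `x`, under `s_1`, and under the Dunkl operator `D`; invariant subspaces are exactly the
submodules of the rational Cherednik algebra module `j₀M`. -/
def IsInvariantSubspace (m : ℕ) (lam : ℂ) (c : ℕ → ℂ) (p : LaurentC) (N : Submodule ℂ LaurentC) : Prop :=
  (∀ f ∈ N, mulX f ∈ N) ∧ (∀ f ∈ N, sOp lam 1 f ∈ N) ∧ (∀ f ∈ N, dunkl m lam c p f ∈ N)

/-- The subspace `x^k ℂ[x]`: the span of the monomials `x^n` with `n ≥ k`. -/
noncomputable def tailSpace (k : ℤ) : Submodule ℂ LaurentC :=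
  Submodule.span ℂ {f : LaurentC | ∃ n : ℤ, k ≤ n ∧ f = Finsupp.single n 1}

def shiftL (j : ℤ) : LaurentC →ₗ[ℂ] LaurentC := Finsupp.lmapDomain ℂ ℂ (· + j)

lemma shiftL_apply (j : ℤ) (f : LaurentC) (n : ℤ) : shiftL j f n = f (n - j) := by
  have h := Finsupp.mapDomain_apply (f := fun x : ℤ => x + j) (add_left_injective j) f (n - j)
  simpa [shiftL, Finsupp.lmapDomain_apply] using h

lemma shiftL_single (j n : ℤ) (a : ℂ) :
    shiftL j (Finsupp.single n a) = Finsupp.single (n + j) a := by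
  simp [shiftL, Finsupp.lmapDomain_apply, Finsupp.mapDomain_single]

lemma shiftL_shiftL (i j : ℤ) (f : LaurentC) : shiftL i (shiftL j f) = shiftL (j + i) f := by
  ext n
  simp only [shiftL_apply]
  congr 1
  ring

lemma onMonomials_single (g : ℤ → LaurentC) (n : ℤ) (a : ℂ) :
    onMonomials g (Finsupp.single n a) = a • g n := by
  simp [onMonomials]

lemma mulX_eq : mulX = shiftL 1 := by
  ext1 n
  ext1
  simp [mulX, onMonomials_single, shiftL_single]

def diagL (a : ℤ → ℂ) : LaurentC →ₗ[ℂ] LaurentC :=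
  onMonomials fun n => Finsupp.single n (a n)

lemma diagL_apply (a : ℤ → ℂ) (f : LaurentC) (n : ℤ) : diagL a f n = a n * f n := by
  induction f using Finsupp.induction_linear with
  | zero => simp
  | add f g hf hg => simp [hf, hg, mul_add]
  | single k b =>
    rw [diagL, onMonomials_single]
    by_cases h : k = n
    · subst h; simp [mul_comm]
    · simp [Finsupp.single_apply, h]

lemma dunkl_eq (m : ℕ) (lam : ℂ) (c : ℕ → ℂ) (p f : LaurentC) :
    dunkl m lam c p f = (∑ j ∈ p.support, p j • shiftL j f) +
      shiftL (-1) (diagL (fun n => (n : ℂ) + ∑ i ∈ Finset.Icc 1 (m - 1),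
          2 * c i * (1 - lam ^ ((i : ℤ) * n)) / (1 - lam ^ (i : ℤ))) f) := by
  induction f using Finsupp.induction_linear with
  | zero => simp
  | add f g hf hg =>
    rw [map_add, hf, hg]
    simp only [map_add, smul_add, Finset.sum_add_distrib]
    abel
  | single k b =>
    rw [dunkl, diagL, onMonomials_single, onMonomials_single, smul_add]
    congr 1
    · rw [Finsupp.mapDomain, Finsupp.sum, Finset.smul_sum]
      refine Finset.sum_congr rfl fun j _ => ?_
      simp [shiftL_single, mul_comm, add_comm]
    · rw [map_smul, shiftL_single, sub_eq_add_neg]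
      simp only [Finsupp.smul_single, smul_eq_mul, mul_one]

lemma shift_mem {N : Submodule ℂ LaurentC} (hx : ∀ f ∈ N, mulX f ∈ N) (j : ℤ) (hj : 0 ≤ j)
    {f : LaurentC} (hf : f ∈ N) : shiftL j f ∈ N := by
  obtain ⟨k, rfl⟩ := Int.eq_ofNat_of_zero_le hj
  clear hj
  induction k with
  | zero =>
    have : shiftL ((0 : ℕ) : ℤ) f = f := by ext n; simp [shiftL_apply]
    rwa [this]
  | succ k ih =>
    have := hx _ ih
    rw [mulX_eq, shiftL_shiftL] at this
    exact_mod_cast this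

lemma mem_of_tail {N : Submodule ℂ LaurentC} (k : ℤ)
    (h : ∀ n, k ≤ n → Finsupp.single n (1 : ℂ) ∈ N) (g : LaurentC)
    (hg : ∀ n, n < k → g n = 0) : g ∈ N := by
  rw [← Finsupp.sum_single g, Finsupp.sum]
  refine Submodule.sum_mem _ fun n hn => ?_
  have hk : k ≤ n := by
    by_contra hlt
    exact (Finsupp.mem_support_iff.mp hn) (hg n (not_le.mp hlt))
  have := N.smul_mem (g n) (h n hk)
  simpa using this

lemma exists_monomial {m : ℕ} {lam : ℂ} {c : ℕ → ℂ} {p : LaurentC} {N : Submodule ℂ LaurentC}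
    (hN : IsInvariantSubspace m lam c p N) (hb : N ≠ ⊥) :
    ∃ n : ℤ, Finsupp.single n (1 : ℂ) ∈ N := by
  classical
  obtain ⟨hx, hs, hD⟩ := hN
  have hex : ∃ d : ℕ, ∃ f ∈ N, f ≠ 0 ∧ f.support.card = d := by
    obtain ⟨f, hf, h0⟩ := N.ne_bot_iff.mp hb
    exact ⟨_, f, hf, h0, rfl⟩
  obtain ⟨f, hf, hf0, hcard⟩ := Nat.find_spec hex
  have hmin : ∀ g ∈ N, g.support.card < f.support.card → g = 0 := by
    intro g hg hlt
    by_contra h0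
    exact Nat.find_min hex (hcard ▸ hlt) ⟨g, hg, h0, rfl⟩
  obtain ⟨b, hbs⟩ := Finsupp.support_nonempty_iff.mpr hf0
  -- key: diagonal operators
  have key : ∀ (a : ℤ → ℂ) (K : ℤ), 0 ≤ K → shiftL K (diagL a f) ∈ N →
      ∀ n ∈ f.support, a n = a b := by
    intro a K hK h n hn
    have h1 : shiftL K (diagL a f - a b • f) ∈ N := by
      rw [map_sub, map_smul]
      exact N.sub_mem h (N.smul_mem _ (shift_mem hx K hK hf))
    have h2 : shiftL K (diagL a f - a b • f) = 0 := by
      apply hmin _ h1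
      have hsub : (diagL a f - a b • f).support ⊂ f.support := by
        refine Finset.ssubset_iff_subset_ne.mpr ⟨?_, ?_⟩
        · intro i hi
          rw [Finsupp.mem_support_iff] at hi ⊢
          intro h0
          exact hi (by simp [diagL_apply, h0])
        · intro he
          rw [← he, Finsupp.mem_support_iff] at hbs
          exact hbs (by simp [diagL_apply])
      refine lt_of_le_of_lt ?_ (Finset.card_lt_card hsub)
      have : (shiftL K (diagL a f - a b • f)).support ⊆
          (diagL a f - a b • f).support.image (· + K) := Finsupp.mapDomain_support
      exact (Finset.card_le_card this).trans Finset.card_image_le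
    have h3 := congrArg (fun g : LaurentC => g (n + K)) h2
    simp only [shiftL_apply, add_sub_cancel_right, Finsupp.sub_apply, diagL_apply,
      Finsupp.smul_apply, smul_eq_mul, Finsupp.coe_zero, Pi.zero_apply] at h3
    rw [← sub_mul] at h3
    rcases mul_eq_zero.mp h3 with h4 | h4
    · exact sub_eq_zero.mp h4
    · exact absurd h4 (Finsupp.mem_support_iff.mp hn)
  have hlamn : ∀ n ∈ f.support, lam ^ n = lam ^ b := by
    refine key (fun n => lam ^ n) 0 le_rfl (shift_mem hx 0 le_rfl ?_)
    have := hs f hf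
    have he : sOp lam 1 = diagL (fun n => lam ^ n) := by simp [sOp, diagL]
    rwa [he] at this
  obtain ⟨K, hK1, hK⟩ : ∃ K : ℤ, 1 ≤ K ∧ ∀ j ∈ p.support, 0 ≤ j + K := by
    obtain ⟨B, hB⟩ := p.support.bddBelow
    refine ⟨max 1 (-B), le_max_left _ _, fun j hj => ?_⟩
    have := hB hj
    have := le_max_right 1 (-B)
    omega
  have hall := key _ (K - 1) (by omega) (by
    have h1 := shift_mem hx K (by omega) (hD f hf)
    rw [dunkl_eq, map_add, map_sum, shiftL_shiftL] at h1
    have h2 : ∑ j ∈ p.support, shiftL K (p j • shiftL j f) ∈ N := by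
      refine Submodule.sum_mem _ fun j hj => ?_
      rw [map_smul, shiftL_shiftL]
      exact N.smul_mem _ (shift_mem hx _ (hK j hj) hf)
    have h3 := (N.add_mem_iff_right h2).mp h1
    rwa [show (-1 : ℤ) + K = K - 1 by ring] at h3)
  have honly : ∀ n ∈ f.support, n = b := by
    intro n hn
    have h := hall n hn
    simp only [zpow_mul', hlamn n hn] at h
    exact_mod_cast add_right_cancel h
  refine ⟨b, ?_⟩
  have hfe : f = Finsupp.single b (f b) := by
    ext n
    by_cases h : b = n
    · subst h; simp
    · rw [Finsupp.single_eq_of_ne (Ne.symm h)]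
      by_contra h0
      exact h (honly n (Finsupp.mem_support_iff.mpr h0)).symm
  have := N.smul_mem (f b)⁻¹ hf
  rw [hfe] at this
  simpa [inv_mul_cancel₀ (Finsupp.mem_support_iff.mp hbs)] using this

/-- If `j₀M` is reducible then some `x^k ℂ[x]` is an invariant subspace. -/
theorem exists_tail_invariant_of_reducible
    (m : ℕ) (hm : 2 ≤ m) (lam : ℂ) (hlam : IsPrimitiveRoot lam m)
    (c : ℕ → ℂ) (p : LaurentC) (hp : ∀ n : ℤ, ¬ ((m : ℤ) ∣ (n + 1)) → p n = 0)
    (hred : ∃ N : Submodule ℂ LaurentC, IsInvariantSubspace m lam c p N ∧ N ≠ ⊥ ∧ N ≠ ⊤) :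
    ∃ k : ℤ, IsInvariantSubspace m lam c p (tailSpace k) := by
  obtain ⟨N, hN, hb, ht⟩ := hred
  have hx := hN.1
  obtain ⟨M, hM⟩ := exists_monomial hN hb
  have hup : ∀ a b : ℤ, a ≤ b → Finsupp.single a (1 : ℂ) ∈ N → Finsupp.single b (1 : ℂ) ∈ N := by
    intro a b hab h
    have := shift_mem hx (b - a) (by omega) h
    rwa [shiftL_single, add_sub_cancel] at this
  obtain ⟨L, hL⟩ : ∃ L : ℤ, Finsupp.single L (1 : ℂ) ∉ N := by
    by_contra hcon
    push Not at hcon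
    refine ht (eq_top_iff.mpr fun f _ => ?_)
    rw [← Finsupp.sum_single f, Finsupp.sum]
    refine Submodule.sum_mem _ fun n _ => ?_
    simpa using N.smul_mem (f n) (hcon n)
  obtain ⟨k, hk, hkmin⟩ := Int.exists_least_of_bdd (P := fun n => Finsupp.single n (1 : ℂ) ∈ N)
    ⟨L, fun z hz => by
      by_contra hlt
      exact hL (hup z L (by omega) hz)⟩ ⟨M, hM⟩
  have htail : ∀ n, k ≤ n → Finsupp.single n (1 : ℂ) ∈ N := fun n hn => hup k n hn hk
  refine ⟨k, ?_⟩
  have heq : tailSpace k = N := by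
    apply le_antisymm
    · refine Submodule.span_le.mpr ?_
      rintro _ ⟨n, hn, rfl⟩
      exact htail n hn
    · intro f hf
      refine mem_of_tail (N := tailSpace k) k (fun n hn => Submodule.subset_span ⟨n, hn, rfl⟩) f ?_
      by_contra hcon
      push Not at hcon
      obtain ⟨B, hB⟩ := f.support.bddBelow
      obtain ⟨n0, ⟨hn0k, hn0⟩, hmin⟩ := Int.exists_least_of_bdd
        (P := fun n => n < k ∧ f n ≠ 0)
        ⟨B, fun z hz => hB (Finsupp.mem_support_iff.mpr hz.2)⟩ hcon
      have h1 := shift_mem hx (k - 1 - n0) (by omega) hf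
      have h2 : shiftL (k - 1 - n0) f - Finsupp.single (k - 1) (f n0) ∈ N := by
        refine mem_of_tail k htail _ fun n hn => ?_
        rw [Finsupp.sub_apply, shiftL_apply]
        by_cases h : n = k - 1
        · subst h; simp
        · rw [Finsupp.single_eq_of_ne h, sub_zero]
          by_contra h0
          have := hmin _ ⟨by omega, h0⟩
          omega
      have h3 : Finsupp.single (k - 1) (f n0) ∈ N := by
        simpa using N.sub_mem h1 h2
      have h4 := N.smul_mem (f n0)⁻¹ h3
      have h5 : Finsupp.single (k - 1) (1 : ℂ) ∈ N := by
        simpa [inv_mul_cancel₀ hn0] using h4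
      have := hkmin _ h5
      omega
  rw [heq]
  exact hN
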